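/- Suppose α is irrational, h = (h₁, h₂) where h₁, h₂ : 𝕋 → 𝕋 are continuous of degrees n₁ and n₂ respectively, and n₂ is odd. Then there exist no continuous map g : 𝕋 → 𝕋² and integer n ≥ 1 such that φⁿ(g(ω), ω) = (g(ω + nα), ω + nα) for all ω ∈ 𝕋; that is, the system (𝕋² × 𝕋, φ) has no periodic continuous graph. (Lemma 5.2.) -/

import Mathlib

/-- 𝕋 = ℝ/ℤ -/
abbrev 𝕋 : Type := UnitAddCircle

/-- 𝕋² = ℝ²/ℤ², realized as 𝕋 × 𝕋 -/
abbrev 𝕋2 : Type := 𝕋 × 𝕋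

/-- The action of the integer matrix A = [[1,1],[2,1]] on 𝕋² = ℝ²/ℤ². -/
noncomputable def Amul (x : 𝕋2) : 𝕋2 := (x.1 + x.2, x.1 + x.1 + x.2)

/-- The quasi-periodically forced system φ(x, ω) = (A·x + h(ω), ω + α),
with h = (h₁, h₂). -/
noncomputable def phi (α : ℝ) (h₁ h₂ : 𝕋 → 𝕋) (p : 𝕋2 × 𝕋) : 𝕋2 × 𝕋 :=
  (Amul p.1 + (h₁ p.2, h₂ p.2), p.2 + (α : 𝕋))

/-- `HasDegree p n` : the continuous map p : 𝕋 → 𝕋 has degree n, i.e. it admits a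
continuous lift P : ℝ → ℝ with P(t) mod ℤ = p(t mod ℤ) and P(t+1) = P(t) + n. -/
def HasDegree (p : 𝕋 → 𝕋) (n : ℤ) : Prop :=
  ∃ P : ℝ → ℝ, Continuous P ∧ (∀ t : ℝ, ((P t : 𝕋)) = p (t : 𝕋)) ∧
    ∀ t : ℝ, P (t + 1) = P t + n

/-- A continuous real function with values in `ℤ` is constant. -/
lemma exists_int_eq_of_continuous {D : ℝ → ℝ} (hD : Continuous D)
    (h : ∀ t, (D t : 𝕋) = 0) : ∃ n : ℤ, ∀ t, D t = n := by
  have h' : ∀ t, ∃ n : ℤ, (n : ℝ) = D t := fun t => by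
    obtain ⟨n, hn⟩ := (AddCircle.coe_eq_zero_iff (1 : ℝ)).1 (h t)
    exact ⟨n, by simpa using hn⟩
  choose n hn using h'
  have hc : Continuous n := by
    rw [Int.isClosedEmbedding_coe_real.isEmbedding.continuous_iff]
    simpa [Function.comp_def, hn] using hD
  exact ⟨n 0, fun t => by rw [← hn t, PreconnectedSpace.constant inferInstance hc]⟩

lemma Continuous.exists_hasDegree {p : 𝕋 → 𝕋} (hp : Continuous p) : ∃ n, HasDegree p n := by
  have hq : Continuous fun t : ℝ => p (t : 𝕋) := hp.comp (AddCircle.continuous_mk' 1)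
  obtain ⟨e, he⟩ := QuotientAddGroup.mk_surjective (p ((0 : ℝ) : 𝕋))
  obtain ⟨F, ⟨-, hF⟩, -⟩ := (AddCircle.isCoveringMap_coe (1 : ℝ)).existsUnique_continuousMap_lifts
    ⟨_, hq⟩ (0 : ℝ) e he
  have hF' : ∀ t : ℝ, ((F t : ℝ) : 𝕋) = p (t : 𝕋) := fun t => congrFun hF t
  obtain ⟨n, hn⟩ := exists_int_eq_of_continuous (D := fun t => F (t + 1) - F t) (by fun_prop)
    (fun t => by
      rw [AddCircle.coe_sub, hF', hF', AddCircle.coe_add, AddCircle.coe_period, add_zero, sub_self])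
  exact ⟨n, F, F.continuous, hF', fun t => by linarith [hn t]⟩

lemma HasDegree.unique {p : 𝕋 → 𝕋} {m n : ℤ} (hm : HasDegree p m) (hn : HasDegree p n) :
    m = n := by
  obtain ⟨P, hPc, hP, hP1⟩ := hm
  obtain ⟨Q, hQc, hQ, hQ1⟩ := hn
  obtain ⟨k, hk⟩ := exists_int_eq_of_continuous (hPc.sub hQc)
    (fun t => by rw [Pi.sub_apply, AddCircle.coe_sub, hP, hQ, sub_self])
  have h0 := hk 0
  have h1 := hk (0 + 1)
  rw [Pi.sub_apply] at h0 h1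
  rw [hP1, hQ1] at h1
  have : (m : ℝ) = n := by linarith
  exact_mod_cast this

lemma HasDegree.add {p q : 𝕋 → 𝕋} {m n : ℤ} (hp : HasDegree p m) (hq : HasDegree q n) :
    HasDegree (fun ω => p ω + q ω) (m + n) := by
  obtain ⟨P, hPc, hP, hP1⟩ := hp
  obtain ⟨Q, hQc, hQ, hQ1⟩ := hq
  refine ⟨fun t => P t + Q t, hPc.add hQc, fun t => ?_, fun t => ?_⟩
  · rw [AddCircle.coe_add, hP, hQ]
  · simp only [hP1, hQ1]
    push_cast
    ring

lemma HasDegree.comp_add_right {p : 𝕋 → 𝕋} {n : ℤ} (hp : HasDegree p n) (c : ℝ) :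
    HasDegree (fun ω => p (ω + (c : 𝕋))) n := by
  obtain ⟨P, hPc, hP, hP1⟩ := hp
  refine ⟨fun t => P (t + c), by fun_prop, fun t => ?_, fun t => ?_⟩
  · rw [hP, AddCircle.coe_add]
  · rw [← hP1, add_right_comm]

/-- The image of a graph of degree `(a, b)` under `φ ^ k` is a graph whose degree is computed by
iterating the affine map `d ↦ A d + (n₁, n₂)`; it is recorded here along the left eigenvector
`(√2, 1)` of `A`, with eigenvalue `1 + √2`. -/
lemma exists_hasDegree_phi_iterate (α : ℝ) {h₁ h₂ g₁ g₂ : 𝕋 → 𝕋} {n₁ n₂ a b : ℤ}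
    (hdeg₁ : HasDegree h₁ n₁) (hdeg₂ : HasDegree h₂ n₂)
    (hg₁ : HasDegree g₁ a) (hg₂ : HasDegree g₂ b) (k : ℕ) :
    ∃ (u v : 𝕋 → 𝕋) (x y : ℤ), HasDegree u x ∧ HasDegree v y ∧
      (∀ ω : 𝕋, (phi α h₁ h₂)^[k] ((g₁ ω, g₂ ω), ω)
        = ((u ω, v ω), ω + (((k : ℝ) * α : ℝ) : 𝕋))) ∧
      √2 * x + y + n₁ + √2 * n₂ / 2 = (1 + √2) ^ k * (√2 * a + b + n₁ + √2 * n₂ / 2) := by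
  induction k with
  | zero => exact ⟨g₁, g₂, a, b, hg₁, hg₂, fun ω => by simp, by simp⟩
  | succ k ih =>
    obtain ⟨u, v, x, y, hu, hv, huv, hxy⟩ := ih
    refine ⟨_, _, _, _, (hu.add hv).add (hdeg₁.comp_add_right (k * α)),
      ((hu.add hu).add hv).add (hdeg₂.comp_add_right (k * α)), fun ω => ?_, ?_⟩
    · rw [Function.iterate_succ_apply', huv]
      have : ((k + 1 : ℕ) : ℝ) * α = k * α + α := by push_cast; ring
      rw [this, AddCircle.coe_add, ← add_assoc]
      rfl
    · have h2 : √2 * √2 = (2 : ℝ) := Real.mul_self_sqrt zero_le_two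
      rw [pow_succ', mul_assoc, ← hxy]
      push_cast
      linear_combination (-(x : ℝ) - n₂ / 2) * h2

lemma sq_ne_two_mul_sq_of_odd {m : ℤ} (hm : Odd m) (k : ℤ) : m ^ 2 ≠ 2 * k ^ 2 := fun h =>
  Int.not_even_iff_odd.2 hm.pow (h ▸ even_two_mul (k ^ 2))

/-- Lemma 5.2: if α is irrational, h₁, h₂ : 𝕋 → 𝕋 are continuous of
degrees n₁, n₂ and n₂ is odd, then there is no continuous g : 𝕋 → 𝕋² and n ≥ 1 with
φⁿ(g(ω), ω) = (g(ω + nα), ω + nα) for all ω: the system has no periodic continuous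
graph. -/
theorem no_periodic_continuous_graph (α : ℝ) (hα : Irrational α)
    (h₁ h₂ : 𝕋 → 𝕋) (hc₁ : Continuous h₁) (hc₂ : Continuous h₂)
    (n₁ n₂ : ℤ) (hdeg₁ : HasDegree h₁ n₁) (hdeg₂ : HasDegree h₂ n₂)
    (hodd : Odd n₂) :
    ¬ ∃ (g : 𝕋 → 𝕋2) (n : ℕ), Continuous g ∧ 1 ≤ n ∧
        ∀ ω : 𝕋, (phi α h₁ h₂)^[n] (g ω, ω)
          = (g (ω + (((n : ℝ) * α : ℝ) : 𝕋)), ω + (((n : ℝ) * α : ℝ) : 𝕋)) := by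
  rintro ⟨g, n, hg, hn, hper⟩
  obtain ⟨a, ha⟩ := (continuous_fst.comp hg).exists_hasDegree
  obtain ⟨b, hb⟩ := (continuous_snd.comp hg).exists_hasDegree
  obtain ⟨u, v, x, y, hu, hv, huv, hxy⟩ :=
    exists_hasDegree_phi_iterate α hdeg₁ hdeg₂ ha hb n
  have hgraph : ∀ ω, (u ω, v ω) = g (ω + (((n : ℝ) * α : ℝ) : 𝕋)) := fun ω =>
    congrArg Prod.fst ((huv ω).symm.trans (hper ω))
  have hxa : x = a := hu.unique <| by
    convert ha.comp_add_right (n * α) using 2 with ω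
    exact congrArg Prod.fst (hgraph ω)
  have hyb : y = b := hv.unique <| by
    convert hb.comp_add_right (n * α) using 2 with ω
    exact congrArg Prod.snd (hgraph ω)
  rw [hxa, hyb] at hxy
  have hpow : 1 < (1 + √2 : ℝ) ^ n :=
    one_lt_pow₀ (lt_add_of_pos_right 1 (Real.sqrt_pos.2 two_pos)) (by omega)
  have hzero : √2 * a + b + n₁ + √2 * n₂ / 2 = (0 : ℝ) := by
    have : ((1 + √2 : ℝ) ^ n - 1) * (√2 * a + b + n₁ + √2 * n₂ / 2) = 0 := by
      linear_combination -hxy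
    exact (mul_eq_zero.1 this).resolve_left (sub_pos.2 hpow).ne'
  have h2 : √2 * √2 = (2 : ℝ) := Real.mul_self_sqrt zero_le_two
  have hsq : ((2 * a + n₂ : ℤ) : ℝ) ^ 2 = 2 * ((b + n₁ : ℤ) : ℝ) ^ 2 := by
    push_cast
    linear_combination (√2 * (2 * a + n₂) - 2 * (b + n₁)) * hzero
      - (2 * a + n₂ : ℝ) ^ 2 / 2 * h2
  exact sq_ne_two_mul_sq_of_odd ((even_two_mul a).add_odd hodd) (b + n₁) (by exact_mod_cast hsq)
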